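/- arXiv:1301.7223 — 8 statements merged into one kernel-verified Lean document; each statement's English description precedes it below -/
import Mathlib

section
/- Let X be a finite T₀ topological space. Then X is a unique path space (i.e. for all x, y ∈ X there is at most one path from y to x) if and only if there are no elements a, b, c, d ∈ X with a < b < d and a < c < d in the specialization order such that b and c are incomparable (neither b ≤ c nor c ≤ b). -/
open Set Topology

variable {X : Type*} [TopologicalSpace X]

/-- Specialization order: `x ≤ y` iff `x ∈ closure {y}`. -/
def SpecLE (x y : X) : Prop := x ∈ closure ({y} : Set X)

/-- Strict specialization order. -/
def SpecLT (x y : X) : Prop := SpecLE x y ∧ ¬ SpecLE y x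

/-- `CoversRel y x` means `y → x`: `x < y` and there is no `z` with `x < z < y`. -/
def CoversRel (y x : X) : Prop := SpecLT x y ∧ ∀ z : X, ¬ (SpecLT x z ∧ SpecLT z y)

/-- `IsPathList y x l`: the list `l = [z₁, …, zₙ]` is a path from `y` to `x`, i.e.
`z₁ = x`, `zₙ = y` and `z_{k+1}` covers `z_k` for each `k`. -/
def IsPathList (y x : X) (l : List X) : Prop :=
  l ≠ [] ∧ l.head? = some x ∧ l.getLast? = some y ∧ l.Chain' (fun a b => CoversRel b a)

/-- `X` is a unique path space if for all `x, y` there is at most one path from `y` to `x`. -/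
def UniquePathSpace (X : Type*) [TopologicalSpace X] : Prop :=
  ∀ x y : X, ∀ l₁ l₂ : List X, IsPathList y x l₁ → IsPathList y x l₂ → l₁ = l₂

/-- The smallest open set containing a set `S` (in a finite space this is open). -/
def tildeSet (S : Set X) : Set X := ⋂₀ {U : Set X | IsOpen U ∧ S ⊆ U}

/-- The smallest open set containing the point `x`, denoted `õ{x}`. -/
def osi (x : X) : Set X := tildeSet {x}

/-- `S` is locally closed: `S = U \ V` for open sets `V ⊆ U`. -/
def LocClosed (S : Set X) : Prop :=
  ∃ U V : Set X, IsOpen U ∧ IsOpen V ∧ V ⊆ U ∧ S = U \ V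

/-- `S` is relatively open in `T`. -/
def RelOpen (S T : Set X) : Prop := ∃ O : Set X, IsOpen O ∧ S = O ∩ T

/-- `S` is relatively closed in `T`. -/
def RelClosed (S T : Set X) : Prop := ∃ Z : Set X, IsClosed Z ∧ S = Z ∩ T

/-- `(U, C)` is a boundary pair: `Y = U ∪ C` is locally closed, `U` is open in `Y`,
and `C = Y \ U`. -/
def BoundaryPair (U C : Set X) : Prop :=
  LocClosed (U ∪ C) ∧ RelOpen U (U ∪ C) ∧ C = (U ∪ C) \ U

/-- An elementary boundary pair. -/
def ElementaryBP (U C : Set X) : Prop :=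
  BoundaryPair U C ∧ IsConnected U ∧ IsConnected C ∧ IsOpen U ∧ IsClosed C ∧
    U ⊆ tildeSet C ∧ C ⊆ closure U

theorem List.exists_isChain_cons_suffix {α : Type*} {r : α → α → Prop} {a b : α} {m : List α}
    (hab : Relation.ReflTransGen r a b) (hm : List.IsChain r (b :: m)) :
    ∃ l : List α, List.IsChain r (a :: l) ∧ (b :: m) <:+ (a :: l) := by
  induction hab using Relation.ReflTransGen.head_induction_on with
  | refl => exact ⟨m, hm, List.suffix_rfl⟩
  | head hac _ ih =>
    obtain ⟨l, hl, hs⟩ := ih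
    exact ⟨_ :: l, List.isChain_cons_cons.2 ⟨hac, hl⟩, hs.trans (List.suffix_cons _ _)⟩

/-- In a finite partial order, any `a ≤ b ≤ d` lie on a common saturated chain from `a` to `d`. -/
theorem exists_isChain_covBy_mem {α : Type*} [PartialOrder α] [Finite α] {a b d : α}
    (hab : a ≤ b) (hbd : b ≤ d) :
    ∃ l : List α, List.IsChain (· ⋖ ·) (a :: l) ∧ (a :: l).getLast? = some d ∧ b ∈ a :: l := by
  classical
  have := Fintype.ofFinite α
  let _ : LocallyFiniteOrder α :=
    @Fintype.toLocallyFiniteOrder α _ _ (Classical.decRel _) (Classical.decRel _)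
  obtain ⟨m, hm, t, ht⟩ := List.exists_isChain_cons_suffix
    (le_iff_reflTransGen_covBy.1 hbd) (List.isChain_singleton (R := (· ⋖ ·)) d)
  obtain ⟨l, hl, s, hs⟩ := List.exists_isChain_cons_suffix
    (le_iff_reflTransGen_covBy.1 hab) hm
  refine ⟨l, hl, ?_, ?_⟩
  · simp [← hs, ← ht]
  · simp [← hs]

theorem List.IsChain.head_lt_of_covBy {α : Type*} [PartialOrder α] {x y : α} {l : List α}
    (hl : List.IsChain (· ⋖ ·) (x :: l)) (hy : y ∈ l) : x < y := by
  have h : List.IsChain (· < ·) (x :: l) := hl.imp fun _ _ h => h.lt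
  exact (List.pairwise_cons.1 h.pairwise).1 y hy

/-- Saturated chains with the same end points agree if all open intervals are totally ordered. -/
theorem List.IsChain.eq_of_covBy {α : Type*} [PartialOrder α]
    (h : ∀ a b c d : α, a < b → b < d → a < c → c < d → b ≤ c ∨ c ≤ b) {y : α} :
    ∀ {x : α} {l₁ l₂ : List α}, List.IsChain (· ⋖ ·) (x :: l₁) → List.IsChain (· ⋖ ·) (x :: l₂) →
      (x :: l₁).getLast? = some y → (x :: l₂).getLast? = some y → l₁ = l₂
  | _, [], [], _, _, _, _ => rfl
  | x, [], c :: t, _, h₂, e₁, e₂ => by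
    have := h₂.head_lt_of_covBy (List.mem_of_getLast? (by simpa using e₂))
    simp_all
  | x, b :: s, [], h₁, _, e₁, e₂ => by
    have := h₁.head_lt_of_covBy (List.mem_of_getLast? (by simpa using e₁))
    simp_all
  | x, b :: s, c :: t, h₁, h₂, e₁, e₂ => by
    rw [List.getLast?_cons_cons] at e₁ e₂
    rw [List.isChain_cons_cons] at h₁ h₂
    have le_last {z : α} {u : List α} (hu : List.IsChain (· ⋖ ·) (z :: u))
        (hy : (z :: u).getLast? = some y) : z ≤ y := by
      rcases List.mem_cons.1 (List.mem_of_getLast? hy) with rfl | hm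
      · exact le_rfl
      · exact (hu.head_lt_of_covBy hm).le
    have hb := le_last h₁.2 e₁
    have hc := le_last h₂.2 e₂
    have hbc : b ≤ c ∨ c ≤ b := by
      rcases hb.eq_or_lt with rfl | hb
      · exact .inr hc
      rcases hc.eq_or_lt with rfl | hc
      · exact .inl hb.le
      exact h x b c y h₁.1.lt hb h₂.1.lt hc
    obtain rfl : b = c := by
      rcases hbc with hbc | hbc
      · exact (h₂.1.eq_or_eq h₁.1.le hbc).resolve_left h₁.1.ne'
      · exact ((h₁.1.eq_or_eq h₂.1.le hbc).resolve_left h₂.1.ne').symm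
    rw [List.IsChain.eq_of_covBy h h₁.2 h₂.2 e₁ e₂]

theorem stmt_0 {X : Type*} [TopologicalSpace X] [Finite X] [T0Space X] :
    UniquePathSpace X ↔
      ¬ ∃ a b c d : X, SpecLT a b ∧ SpecLT b d ∧ SpecLT a c ∧ SpecLT c d ∧
        ¬ SpecLE b c ∧ ¬ SpecLE c b := by
  let _ : PartialOrder X := specializationOrder X
  have hle (x y : X) : SpecLE x y ↔ x ≤ y := specializes_iff_mem_closure.symm
  have hlt (x y : X) : SpecLT x y ↔ x < y := by
    rw [SpecLT, hle, hle, lt_iff_le_not_ge]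
  have hcov : (fun a b : X => CoversRel b a) = (· ⋖ ·) := by
    ext a b
    simp only [CoversRel, hlt, CovBy, not_and]
  have hpath (x y : X) (l : List X) : IsPathList y x l ↔
      ∃ t, l = x :: t ∧ List.IsChain (· ⋖ ·) (x :: t) ∧ (x :: t).getLast? = some y := by
    unfold IsPathList
    rw [hcov]
    constructor
    · rintro ⟨-, hx, hy, hl⟩
      obtain ⟨t, rfl⟩ := List.head?_eq_some_iff.1 hx
      exact ⟨t, rfl, hl, hy⟩
    · rintro ⟨t, rfl, hl, hy⟩
      exact ⟨List.cons_ne_nil _ _, rfl, hy, hl⟩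
  simp only [hlt, hle]
  constructor
  · rintro hX ⟨a, b, c, d, hab, hbd, hac, hcd, hbc, hcb⟩
    obtain ⟨s, hs, es, hbs⟩ := exists_isChain_covBy_mem hab.le hbd.le
    obtain ⟨t, ht, et, hct⟩ := exists_isChain_covBy_mem hac.le hcd.le
    have hst := hX a d _ _ ((hpath _ _ _).2 ⟨s, rfl, hs, es⟩) ((hpath _ _ _).2 ⟨t, rfl, ht, et⟩)
    rw [← hst] at hct
    have hp : List.Pairwise (· < ·) (a :: s) :=
      List.IsChain.pairwise (hs.imp fun _ _ h => h.lt)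
    have : Std.Symm (fun u v : X => u ≤ v ∨ v ≤ u) := ⟨fun _ _ h => h.symm⟩
    have hcomp : b ≤ c ∨ c ≤ b :=
      List.Pairwise.forall_of_forall (R := fun u v : X => u ≤ v ∨ v ≤ u)
        (fun _ _ => Or.inl le_rfl) (hp.imp fun h => Or.inl h.le) hbs hct
    exact hcomp.elim hbc hcb
  · intro hX x y l₁ l₂ h₁ h₂
    obtain ⟨s, rfl, hs, es⟩ := (hpath _ _ _).1 h₁
    obtain ⟨t, rfl, ht, et⟩ := (hpath _ _ _).1 h₂
    rw [List.IsChain.eq_of_covBy _ hs ht es et]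
    intro a b c d hab hbd hac hcd
    by_contra! hbc
    exact hX ⟨a, b, c, d, hab, hbd, hac, hcd, hbc.1, hbc.2⟩
end

section
/- Let X be a finite T₀ topological space. Then X is a unique path space if and only if for all x, y ∈ X with x covering y in the specialization order, the set õ{x} ∪ closure {y} is locally closed in X, where õ{x} denotes the smallest open subset of X containing x. -/
open Set Topology

variable {X : Type*} [TopologicalSpace X]

theorem List.IsChain.append_of_getLast? {α : Type*} {r : α → α → Prop} {a b c d : α}
    {l₁ l₂ : List α}
    (h₁ : (a :: l₁).IsChain r) (hb : (a :: l₁).getLast? = some b) (h₂ : (c :: l₂).IsChain r)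
    (hd : (c :: l₂).getLast? = some d) (hbc : r b c) :
    (a :: (l₁ ++ c :: l₂)).IsChain r ∧ (a :: (l₁ ++ c :: l₂)).getLast? = some d := by
  rw [← List.cons_append]
  refine ⟨List.isChain_append.2 ⟨h₁, h₂, ?_⟩, ?_⟩
  · simp_all
  · rw [List.getLast?_append, hd]; rfl

section CovByChain

variable {α : Type*} [PartialOrder α]

theorem List.IsChain.le_of_mem_covBy_cons {a b : α} {l : List α}
    (h : (a :: l).IsChain (· ⋖ ·)) (hb : b ∈ a :: l) : a ≤ b := by
  induction l generalizing a with
  | nil => simp_all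
  | cons c l ih =>
    rw [List.isChain_cons_cons] at h
    rcases List.mem_cons.1 hb with rfl | hb
    · exact le_rfl
    · exact h.1.le.trans (ih h.2 hb)

theorem List.IsChain.mem_covBy_le_getLast {a b c : α} {l : List α}
    (h : (a :: l).IsChain (· ⋖ ·)) (hc : (a :: l).getLast? = some c) (hb : b ∈ a :: l) :
    b ≤ c := by
  induction l generalizing a with
  | nil => simp_all
  | cons d l ih =>
    have hcm : c ∈ a :: d :: l := List.mem_of_getLast? hc
    rcases List.mem_cons.1 hb with rfl | hb
    · exact h.le_of_mem_covBy_cons hcm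
    · exact ih (List.isChain_cons_cons.1 h).2 (by simpa using hc) hb

theorem List.eq_of_isChain_covBy_of_ordConnected
    (h : ∀ x y : α, y ⋖ x → (Ici x ∪ Iic y).OrdConnected) {a c : α} {l₁ l₂ : List α}
    (h₁ : (a :: l₁).IsChain (· ⋖ ·)) (h₂ : (a :: l₂).IsChain (· ⋖ ·))
    (hc₁ : (a :: l₁).getLast? = some c) (hc₂ : (a :: l₂).getLast? = some c) : l₁ = l₂ := by
  induction l₁ generalizing a l₂ with
  | nil =>
    obtain rfl : a = c := by simpa using hc₁
    cases l₂ with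
    | nil => rfl
    | cons q l₂ =>
      rw [List.isChain_cons_cons] at h₂
      exact absurd (h₂.2.mem_covBy_le_getLast (by simpa using hc₂) List.mem_cons_self)
        h₂.1.lt.not_ge
  | cons p l₁ ih =>
    rw [List.isChain_cons_cons] at h₁
    have hpc := h₁.2.mem_covBy_le_getLast (by simpa using hc₁) List.mem_cons_self
    cases l₂ with
    | nil =>
      obtain rfl : a = c := by simpa using hc₂
      exact absurd hpc h₁.1.lt.not_ge
    | cons q l₂ =>
      rw [List.isChain_cons_cons] at h₂
      have hqc := h₂.2.mem_covBy_le_getLast (by simpa using hc₂) List.mem_cons_self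
      rcases (h p a h₁.1).out (Or.inr le_rfl) (Or.inl hpc) ⟨h₂.1.le, hqc⟩ with hpq | hqa
      · obtain rfl : p = q := (h₂.1.eq_or_eq h₁.1.le hpq).resolve_left h₁.1.ne'
        rw [ih h₁.2 h₂.2 (by simpa using hc₁) (by simpa using hc₂)]
      · exact absurd hqa h₂.1.lt.not_ge

theorem exists_isChain_covBy_of_le [Finite α] {a c : α} (h : a ≤ c) :
    ∃ l, (a :: l).IsChain (· ⋖ ·) ∧ (a :: l).getLast? = some c := by
  classical
  have := Fintype.ofFinite α
  let : LocallyFiniteOrder α := Fintype.toLocallyFiniteOrder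
  obtain ⟨l, hl, hc⟩ :=
    List.exists_isChain_cons_of_relationReflTransGen (le_iff_reflTransGen_covBy.1 h)
  exact ⟨l, hl, by rw [List.getLast?_eq_some_getLast (List.cons_ne_nil _ _), hc]⟩

theorem exists_isChain_covBy_of_le_of_le [Finite α] {a b c : α} (hab : a ≤ b) (hbc : b ≤ c) :
    ∃ l, (a :: l).IsChain (· ⋖ ·) ∧ (a :: l).getLast? = some c ∧ b ∈ a :: l := by
  obtain ⟨l₁, h₁, hb⟩ := exists_isChain_covBy_of_le hab
  obtain ⟨l₂, h₂, hc⟩ := exists_isChain_covBy_of_le hbc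
  cases l₂ with
  | nil =>
    obtain rfl : b = c := by simpa using hc
    exact ⟨l₁, h₁, hb, List.mem_of_getLast? hb⟩
  | cons d l₂ =>
    rw [List.isChain_cons_cons] at h₂
    obtain ⟨h, hl⟩ := h₁.append_of_getLast? hb h₂.2 (by simpa using hc) h₂.1
    refine ⟨_, h, hl, ?_⟩
    rw [← List.cons_append]
    exact List.mem_append_left _ (List.mem_of_getLast? hb)

theorem ordConnected_Ici_union_Iic_of_isChain_covBy_unique [Finite α]
    (h : ∀ (a c : α) (l₁ l₂ : List α), (a :: l₁).IsChain (· ⋖ ·) → (a :: l₂).IsChain (· ⋖ ·) →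
      (a :: l₁).getLast? = some c → (a :: l₂).getLast? = some c → l₁ = l₂)
    {x y : α} (hyx : y ⋖ x) : (Ici x ∪ Iic y).OrdConnected := by
  refine ⟨fun a ha c hc b ⟨hab, hbc⟩ => ?_⟩
  rcases ha with ha | ha
  · exact Or.inl (ha.trans hab)
  rcases hc with hc | hc
  swap
  · exact Or.inr (hbc.trans hc)
  obtain ⟨l₁, h₁, hy⟩ := exists_isChain_covBy_of_le ha
  obtain ⟨l₂, h₂, hl₂⟩ := exists_isChain_covBy_of_le hc
  obtain ⟨l, hl, hlc, hb⟩ := exists_isChain_covBy_of_le_of_le hab hbc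
  obtain ⟨h₃, hl₃⟩ := h₁.append_of_getLast? hy h₂ hl₂ hyx
  rw [h _ _ _ _ hl h₃ hlc hl₃, ← List.cons_append] at hb
  rcases List.mem_append.1 hb with hb | hb
  · exact Or.inr (h₁.mem_covBy_le_getLast hy hb)
  · exact Or.inl (h₂.le_of_mem_covBy_cons hb)

theorem forall_isChain_covBy_unique_iff [Finite α] :
    (∀ (a c : α) (l₁ l₂ : List α), (a :: l₁).IsChain (· ⋖ ·) → (a :: l₂).IsChain (· ⋖ ·) →
      (a :: l₁).getLast? = some c → (a :: l₂).getLast? = some c → l₁ = l₂) ↔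
    ∀ x y : α, y ⋖ x → (Ici x ∪ Iic y).OrdConnected :=
  ⟨fun h _ _ => ordConnected_Ici_union_Iic_of_isChain_covBy_unique h,
    fun h _ _ _ _ => List.eq_of_isChain_covBy_of_ordConnected h⟩

end CovByChain

section Specialization

attribute [local instance] specializationOrder

theorem isOpen_iff_isUpperSet_specialization [AlexandrovDiscrete X] [T0Space X] {s : Set X} :
    IsOpen s ↔ IsUpperSet s :=
  isOpen_iff_forall_specializes.trans forall_comm

theorem specLE_iff_le [T0Space X] {x y : X} : SpecLE x y ↔ x ≤ y :=
  specializes_iff_mem_closure.symm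

theorem coversRel_iff_covBy [T0Space X] {x y : X} : CoversRel y x ↔ x ⋖ y := by
  simp only [CoversRel, SpecLT, specLE_iff_le, ← lt_iff_le_not_ge, CovBy, not_and]

theorem closure_singleton_eq_Iic_specialization [T0Space X] (x : X) : closure ({x} : Set X) = Iic x :=
  Set.ext fun _ => specLE_iff_le

theorem osi_eq_Ici [AlexandrovDiscrete X] [T0Space X] (x : X) : osi x = Ici x := by
  refine Subset.antisymm ?_ (subset_sInter fun U hU z hz => ?_)
  · exact sInter_subset_of_mem
      ⟨isOpen_iff_isUpperSet_specialization.2 (isUpperSet_Ici x), by simp⟩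
  · exact isOpen_iff_isUpperSet_specialization.1 hU.1 hz (hU.2 rfl)

theorem locClosed_iff_ordConnected [AlexandrovDiscrete X] [T0Space X] {s : Set X} :
    LocClosed s ↔ s.OrdConnected := by
  simp only [LocClosed, isOpen_iff_isUpperSet_specialization]
  constructor
  · rintro ⟨U, V, hU, hV, -, rfl⟩
    exact hU.ordConnected.inter hV.compl.ordConnected
  · intro hs
    refine ⟨upperClosure s, upperClosure s \ s, (upperClosure s).upper, ?_, sdiff_subset, ?_⟩
    · rintro a b hab ⟨ha, has⟩
      refine ⟨(upperClosure s).upper hab ha, fun hbs => has ?_⟩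
      obtain ⟨c, hc, hca⟩ := ha
      exact hs.out hc hbs ⟨hca, hab⟩
    · rw [sdiff_sdiff_cancel_left subset_upperClosure]

theorem uniquePathSpace_iff_isChain_covBy [T0Space X] :
    UniquePathSpace X ↔ ∀ (a c : X) (l₁ l₂ : List X), (a :: l₁).IsChain (· ⋖ ·) →
      (a :: l₂).IsChain (· ⋖ ·) → (a :: l₁).getLast? = some c → (a :: l₂).getLast? = some c →
      l₁ = l₂ := by
  simp only [UniquePathSpace, IsPathList, coversRel_iff_covBy]
  constructor
  · intro h a c l₁ l₂ h₁ h₂ hc₁ hc₂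
    exact List.tail_eq_of_cons_eq (h a c (a :: l₁) (a :: l₂)
      ⟨List.cons_ne_nil _ _, rfl, hc₁, h₁⟩ ⟨List.cons_ne_nil _ _, rfl, hc₂, h₂⟩)
  · rintro h a c (_ | ⟨a₁, l₁⟩) (_ | ⟨a₂, l₂⟩) ⟨hn₁, ha₁, hc₁, h₁⟩ ⟨hn₂, ha₂, hc₂, h₂⟩
    · rfl
    · exact absurd rfl hn₁
    · exact absurd rfl hn₂
    · obtain rfl : a₁ = a := by simpa using ha₁
      obtain rfl : a₂ = a₁ := by simpa using ha₂
      rw [h _ _ _ _ h₁ h₂ hc₁ hc₂]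

end Specialization

theorem stmt_1 {X : Type*} [TopologicalSpace X] [Finite X] [T0Space X] :
    UniquePathSpace X ↔
      ∀ x y : X, CoversRel x y → LocClosed (osi x ∪ closure ({y} : Set X)) := by
  simp only [uniquePathSpace_iff_isChain_covBy, coversRel_iff_covBy, osi_eq_Ici,
    closure_singleton_eq_Iic_specialization, locClosed_iff_ordConnected]
  let := specializationOrder X
  exact forall_isChain_covBy_unique_iff
end

section
/- Let X be a finite T₀ topological space. Then X is a unique path space if and only if for every x ∈ X the following holds: the sets õ{y}, for y ranging over the elements covering x in the specialization order, are pairwise disjoint and their union equals õ{x} \ {x}, where õ{z} denotes the smallest open subset of X containing z. -/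
open Set Topology

variable {X : Type*} [TopologicalSpace X]

theorem exists_isChain_covBy_of_le_s3 {α : Type*} [PartialOrder α] [Finite α] {x y : α}
    (h : x ≤ y) :
    ∃ l : List α, l.head? = some x ∧ l.getLast? = some y ∧ l.IsChain (· ⋖ ·) := by
  induction x using (wellFounded_gt (α := α)).induction with
  | _ x ih =>
    rcases h.eq_or_lt with rfl | h
    · exact ⟨[x], by simp⟩
    · obtain ⟨z, hxz, hzy⟩ := h.exists_covby_le
      obtain ⟨l, h₁, h₂, h₃⟩ := ih z hxz.lt hzy
      cases l with
      | nil => simp at h₁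
      | cons a t =>
        obtain rfl : a = z := by simpa using h₁
        exact ⟨x :: a :: t, by simp, by simpa using h₂, List.isChain_cons_cons.2 ⟨hxz, h₃⟩⟩

theorem le_of_isChain_covBy {α : Type*} [PartialOrder α] {x y : α} {l : List α}
    (hl : (x :: l).IsChain (· ⋖ ·)) (hy : (x :: l).getLast? = some y) : x ≤ y := by
  induction l generalizing x with
  | nil => simp_all
  | cons a t ih =>
    rw [List.isChain_cons_cons] at hl
    exact hl.1.le.trans (ih hl.2 (by simpa using hy))

theorem isChain_covBy_unique {α : Type*} [PartialOrder α]
    (H : ∀ x y₁ y₂ z : α, x ⋖ y₁ → x ⋖ y₂ → y₁ ≤ z → y₂ ≤ z → y₁ = y₂) {x y : α}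
    {l₁ l₂ : List α} (h₁ : (x :: l₁).IsChain (· ⋖ ·)) (h₂ : (x :: l₂).IsChain (· ⋖ ·))
    (e₁ : (x :: l₁).getLast? = some y) (e₂ : (x :: l₂).getLast? = some y) : l₁ = l₂ := by
  induction l₁ generalizing x l₂ with
  | nil =>
    obtain rfl : x = y := by simpa using e₁
    cases l₂ with
    | nil => rfl
    | cons b s =>
      rw [List.isChain_cons_cons] at h₂
      exact absurd (le_of_isChain_covBy h₂.2 (by simpa using e₂)) h₂.1.lt.not_ge
  | cons a t ih =>
    rw [List.isChain_cons_cons] at h₁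
    have ha := le_of_isChain_covBy h₁.2 (by simpa using e₁)
    cases l₂ with
    | nil =>
      obtain rfl : x = y := by simpa using e₂
      exact absurd ha h₁.1.lt.not_ge
    | cons b s =>
      rw [List.isChain_cons_cons] at h₂
      have hb := le_of_isChain_covBy h₂.2 (by simpa using e₂)
      obtain rfl := H x a b y h₁.1 h₂.1 ha hb
      rw [ih h₁.2 h₂.2 (by simpa using e₁) (by simpa using e₂)]

theorem mem_osi {X : Type*} [TopologicalSpace X] {x z : X} :
    z ∈ osi x ↔ SpecLE x z := by
  simp only [osi, tildeSet, SpecLE, mem_sInter, mem_ofPred_eq, singleton_subset_iff,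
    and_imp, mem_closure_iff, inter_singleton_nonempty]

theorem coversRel_iff_covBy_s3 {X : Type*} [TopologicalSpace X] [T0Space X] {x y : X} :
    letI := specializationOrder X
    CoversRel y x ↔ x ⋖ y := by
  let := specializationOrder X
  have hle (a b : X) : SpecLE a b ↔ a ≤ b := specializes_iff_mem_closure.symm
  simp only [CoversRel, SpecLT, hle, ← lt_iff_le_not_ge, CovBy, not_and]

theorem stmt_3 {X : Type*} [TopologicalSpace X] [Finite X] [T0Space X] :
    UniquePathSpace X ↔
      ∀ x : X,
        (∀ y₁ y₂ : X, CoversRel y₁ x → CoversRel y₂ x → y₁ ≠ y₂ → osi y₁ ∩ osi y₂ = ∅) ∧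
        (⋃ y ∈ {y : X | CoversRel y x}, osi y) = osi x \ {x} := by
  let := specializationOrder X
  have hle (a b : X) : SpecLE a b ↔ a ≤ b := specializes_iff_mem_closure.symm
  have hpath (y x : X) (l : List X) : IsPathList y x l ↔
      l.head? = some x ∧ l.getLast? = some y ∧ l.IsChain (· ⋖ ·) := by
    simp only [IsPathList, List.Chain', coversRel_iff_covBy_s3]
    refine ⟨fun h => h.2, fun h => ⟨?_, h⟩⟩
    rintro rfl
    simp at h
  simp only [UniquePathSpace, hpath, coversRel_iff_covBy_s3]
  constructor
  · intro H x
    constructor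
    · intro y₁ y₂ h₁ h₂ hne
      refine eq_empty_of_forall_notMem fun z hz => hne ?_
      simp only [mem_inter_iff, mem_osi, hle] at hz
      obtain ⟨l₁, a₁, b₁, c₁⟩ := exists_isChain_covBy_of_le_s3 hz.1
      obtain ⟨l₂, a₂, b₂, c₂⟩ := exists_isChain_covBy_of_le_s3 hz.2
      obtain ⟨t₁, rfl⟩ := List.head?_eq_some_iff.1 a₁
      obtain ⟨t₂, rfl⟩ := List.head?_eq_some_iff.1 a₂
      have := H x z (x :: y₁ :: t₁) (x :: y₂ :: t₂)
        ⟨rfl, by simpa using b₁, List.isChain_cons_cons.2 ⟨h₁, c₁⟩⟩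
        ⟨rfl, by simpa using b₂, List.isChain_cons_cons.2 ⟨h₂, c₂⟩⟩
      simp only [List.cons.injEq, true_and] at this
      exact this.1
    · ext z
      simp only [mem_iUnion, mem_ofPred_eq, exists_prop, mem_osi, hle, mem_sdiff,
        mem_singleton_iff]
      constructor
      · rintro ⟨y, hxy, hyz⟩
        exact ⟨hxy.le.trans hyz, (hxy.lt.trans_le hyz).ne'⟩
      · rintro ⟨hxz, hne⟩
        exact (lt_of_le_of_ne hxz (Ne.symm hne)).exists_covby_le
  · rintro H x y l₁ l₂ ⟨a₁, b₁, c₁⟩ ⟨a₂, b₂, c₂⟩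
    obtain ⟨t₁, rfl⟩ := List.head?_eq_some_iff.1 a₁
    obtain ⟨t₂, rfl⟩ := List.head?_eq_some_iff.1 a₂
    rw [isChain_covBy_unique ?_ c₁ c₂ b₁ b₂]
    intro x y₁ y₂ z h₁ h₂ hz₁ hz₂
    by_contra hne
    have hz : z ∈ osi y₁ ∩ osi y₂ := by simp only [mem_inter_iff, mem_osi, hle, hz₁, hz₂, and_self]
    simp [(H x).1 y₁ y₂ h₁ h₂ hne] at hz
end

section
/- Every accordion space is an EBP space: if X is an accordion space, then X is a unique path space, and every elementary boundary pair (U, C) in X is of the form (õ{x}, closure {y}) for some points x, y ∈ X with x covering y. -/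
open Set Topology

variable {X : Type*} [TopologicalSpace X]

/-- `X` is an EBP space: a unique path space in which every elementary boundary pair is
of the form `(õ{x}, closure {y})` with `x` covering `y`. -/
def IsEBP (X : Type*) [TopologicalSpace X] : Prop :=
  UniquePathSpace X ∧
    ∀ U C : Set X, ElementaryBP U C →
      ∃ x y : X, CoversRel x y ∧ U = osi x ∧ C = closure ({y} : Set X)

/-- `X` is an accordion space: it admits an enumeration `x₁, …, xₙ` such that consecutive
points are related by the covering relation (in one direction or the other) and no covering
relation holds between points with index distance different from `1`. -/
def IsAccordion (X : Type*) [TopologicalSpace X] : Prop :=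
  ∃ (n : ℕ) (e : Fin n ≃ X),
    (∀ (i : ℕ) (h1 : i + 1 < n),
      CoversRel (e ⟨i, Nat.lt_of_succ_lt h1⟩) (e ⟨i + 1, h1⟩) ∨
        CoversRel (e ⟨i + 1, h1⟩) (e ⟨i, Nat.lt_of_succ_lt h1⟩)) ∧
    (∀ i j : Fin n, (((i : ℕ) : ℤ) - ((j : ℕ) : ℤ)).natAbs ≠ 1 → ¬ CoversRel (e i) (e j))

open Relation

lemma specLE_iff_specializes {x y : X} : SpecLE x y ↔ y ⤳ x :=
  specializes_iff_mem_closure.symm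

lemma SpecLE.reflTransGen_coversRel [Finite X] [T0Space X] {x y : X} (h : SpecLE x y) :
    ReflTransGen (fun a b => CoversRel b a) x y := by
  classical
  let : PartialOrder X := specializationOrder X
  have := Fintype.ofFinite X
  let : LocallyFiniteOrder X := Fintype.toLocallyFiniteOrder
  have hle : ∀ a b : X, a ≤ b ↔ SpecLE a b := fun a b => specLE_iff_specializes.symm
  have hlt : ∀ a b : X, a < b ↔ SpecLT a b := fun a b => by
    rw [lt_iff_le_not_ge, hle, hle, SpecLT]
  refine ReflTransGen.mono ?_ _ _ (le_iff_reflTransGen_covBy.1 ((hle x y).2 h))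
  intro a b hab
  exact ⟨(hlt _ _).1 hab.1, fun z hz => hab.2 ((hlt _ _).2 hz.1) ((hlt _ _).2 hz.2)⟩

lemma SpecLE.trans {x y z : X} (h : SpecLE x y) (h' : SpecLE y z) : SpecLE x z :=
  specLE_iff_specializes.2
    ((specLE_iff_specializes.1 h').trans (specLE_iff_specializes.1 h))

lemma specLE_of_reflTransGen {x y : X}
    (h : ReflTransGen (fun a b => CoversRel b a) x y) : SpecLE x y := by
  induction h with
  | refl => exact subset_closure rfl
  | tail _ hbc ih => exact ih.trans hbc.1.1

lemma IsOpen.mem_of_specLE {U : Set X} (hU : IsOpen U) {x y : X} (h : SpecLE x y)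
    (hx : x ∈ U) : y ∈ U :=
  (specLE_iff_specializes.1 h).mem_open hU hx

lemma IsClosed.mem_of_specLE {C : Set X} (hC : IsClosed C) {x y : X} (h : SpecLE x y)
    (hy : y ∈ C) : x ∈ C :=
  (specLE_iff_specializes.1 h).mem_closed hC hy

lemma mem_of_specLE_of_coversRel [Finite X] [T0Space X] {P : Set X}
    (hP : ∀ a ∈ P, ∀ b, CoversRel b a → b ∈ P) {x y : X} (hx : x ∈ P) (h : SpecLE x y) :
    y ∈ P := by
  induction h.reflTransGen_coversRel with
  | refl => exact hx
  | tail _ hbc ih => exact hP _ (ih (specLE_of_reflTransGen ‹_›)) _ hbc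

lemma isOpen_of_coversRel [Finite X] [T0Space X] {P : Set X}
    (hP : ∀ a ∈ P, ∀ b, CoversRel b a → b ∈ P) : IsOpen P :=
  isOpen_iff_forall_specializes.2 fun _ _ h hy =>
    mem_of_specLE_of_coversRel hP hy (specLE_iff_specializes.2 h)

lemma isClosed_of_coversRel [Finite X] [T0Space X] {P : Set X}
    (hP : ∀ a ∈ P, ∀ b, CoversRel a b → b ∈ P) : IsClosed P := by
  rw [← isOpen_compl_iff]
  exact isOpen_of_coversRel fun a ha b hb hbP => ha (hP b hbP a hb)

lemma exists_specLE_of_mem_tildeSet [Finite X] [T0Space X] {C : Set X} {u : X}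
    (hu : u ∈ tildeSet C) : ∃ c ∈ C, SpecLE c u := by
  refine hu {z | ∃ c ∈ C, SpecLE c z} ⟨isOpen_of_coversRel ?_, fun c hc => ?_⟩
  · rintro a ⟨c, hc, hca⟩ b hb
    exact ⟨c, hc, hca.trans hb.1.1⟩
  · exact ⟨c, hc, subset_closure rfl⟩

lemma exists_specLE_of_mem_closure [Finite X] [T0Space X] {U : Set X} {c : X}
    (hc : c ∈ closure U) : ∃ u ∈ U, SpecLE c u := by
  refine closure_minimal (t := {z | ∃ u ∈ U, SpecLE z u}) (fun u hu => ?_)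
    (isClosed_of_coversRel ?_) hc
  · exact ⟨u, hu, subset_closure rfl⟩
  · rintro a ⟨u, hu, hau⟩ b hb
    exact ⟨u, hu, hb.1.1.trans hau⟩

/-- Points related by the covering relation have adjacent values under `f`. -/
def AdjacentOnCovers (f : X → ℕ) : Prop :=
  ∀ x y : X, CoversRel x y → f x = f y + 1 ∨ f y = f x + 1

lemma IsAccordion.exists_adjacentOnCovers (h : IsAccordion X) :
    ∃ f : X → ℕ, Function.Injective f ∧ AdjacentOnCovers f := by
  obtain ⟨n, e, -, he⟩ := h
  refine ⟨fun x => (e.symm x : ℕ), Fin.val_injective.comp e.symm.injective, fun x y hxy => ?_⟩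
  have := mt (he (e.symm x) (e.symm y)) (by simpa using hxy)
  dsimp only
  omega

namespace AdjacentOnCovers

variable {f : X → ℕ}

lemma uniquePathSpace [Finite X] [T0Space X] (hf : AdjacentOnCovers f)
    (hinj : Function.Injective f) : UniquePathSpace X := by
  have not_below : ∀ x z : X, CoversRel z x → ∀ y, SpecLE z y → ¬ SpecLE y x :=
    fun x z h y hzy hyx => h.1.2 (hzy.trans hyx)
  have above : ∀ x a y : X, CoversRel a x → SpecLE a y → (f x < f a ↔ f x < f y) := by
    intro x a y hxa hay
    refine (mem_of_specLE_of_coversRel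
      (P := {z | SpecLE a z ∧ (f x < f a ↔ f x < f z)}) ?_ ⟨subset_closure rfl, Iff.rfl⟩ hay).2
    rintro b ⟨hab, hb⟩ c hcb
    have hac := hab.trans hcb.1.1
    have hbx : f b ≠ f x := fun h =>
      not_below x a hxa b hab (hinj h ▸ subset_closure rfl)
    have hcx : f c ≠ f x := fun h =>
      not_below x a hxa c hac (hinj h ▸ subset_closure rfl)
    exact ⟨hac, by have := hf c b hcb; omega⟩
  have le_of_path : ∀ (l : List X) (x y : X), IsPathList y x l → SpecLE x y := by
    intro l
    induction l with
    | nil => exact fun x y h => absurd rfl h.1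
    | cons a l ih =>
      rintro x y ⟨-, hx, hy, hl⟩
      obtain rfl : a = x := by simpa using hx
      cases l with
      | nil =>
        obtain rfl : a = y := by simpa using hy
        exact subset_closure rfl
      | cons b l =>
        have hl := List.isChain_cons_cons.1 hl
        exact hl.1.1.1.trans (ih b y ⟨by simp, rfl, by simpa using hy, hl.2⟩)
  intro x y l₁
  induction l₁ generalizing x with
  | nil => exact fun l₂ h => absurd rfl h.1
  | cons a l₁ ih =>
    rintro (_ | ⟨a', l₂⟩) ⟨-, hx, hy, hl⟩ ⟨h₂, hx', hy', hl'⟩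
    · exact absurd rfl h₂
    obtain rfl : a = x := by simpa using hx
    obtain rfl : a' = a := by simpa using hx'
    rcases l₁ with _ | ⟨b, l₁⟩ <;> rcases l₂ with _ | ⟨b', l₂⟩
    · rfl
    · obtain rfl : a' = y := by simpa using hy
      have hl' := List.isChain_cons_cons.1 hl'
      have := le_of_path (b' :: l₂) b' a' ⟨by simp, rfl, by simpa using hy', hl'.2⟩
      exact absurd this hl'.1.1.2
    · obtain rfl : a' = y := by simpa using hy'
      have hl := List.isChain_cons_cons.1 hl
      have := le_of_path (b :: l₁) b a' ⟨by simp, rfl, by simpa using hy, hl.2⟩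
      exact absurd this hl.1.1.2
    · have hl := List.isChain_cons_cons.1 hl
      have hl' := List.isChain_cons_cons.1 hl'
      have hp : IsPathList y b (b :: l₁) := ⟨by simp, rfl, by simpa using hy, hl.2⟩
      have hp' : IsPathList y b' (b' :: l₂) := ⟨by simp, rfl, by simpa using hy', hl'.2⟩
      have hb := above _ _ _ hl.1 (le_of_path _ _ _ hp)
      have hb' := above _ _ _ hl'.1 (le_of_path _ _ _ hp')
      obtain rfl : b = b' := hinj (by
        have := hf _ _ hl.1
        have := hf _ _ hl'.1
        omega)
      rw [ih b _ hp hp']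

lemma exists_mem_eq_of_isOpen [Finite X] [T0Space X] (hf : AdjacentOnCovers f) {S : Set X}
    (hS : IsPreconnected S) (hO : IsOpen S) {a b : X} (ha : a ∈ S) (hb : b ∈ S) {k : ℕ}
    (hak : f a < k) (hkb : k < f b) : ∃ z ∈ S, f z = k := by
  by_contra! hk
  have hl : IsOpen {z | z ∈ S ∧ f z < k} := isOpen_of_coversRel fun p hp q hq => by
    have hqS := hO.mem_of_specLE hq.1.1 hp.1
    have := hp.2
    have := hk q hqS
    exact ⟨hqS, by have := hf q p hq; omega⟩
  have hr : IsOpen {z | z ∈ S ∧ k < f z} := isOpen_of_coversRel fun p hp q hq => by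
    have hqS := hO.mem_of_specLE hq.1.1 hp.1
    have := hp.2
    have := hk q hqS
    exact ⟨hqS, by have := hf q p hq; omega⟩
  obtain ⟨z, -, hz, hz'⟩ := hS _ _ hl hr
    (fun z hz => (hk z hz).lt_or_gt.imp (fun h => ⟨hz, h⟩) fun h => ⟨hz, h⟩)
    ⟨a, ha, ha, hak⟩ ⟨b, hb, hb, hkb⟩
  exact lt_asymm hz.2 hz'.2

lemma exists_mem_eq_of_isClosed [Finite X] [T0Space X] (hf : AdjacentOnCovers f) {S : Set X}
    (hS : IsPreconnected S) (hC : IsClosed S) {a b : X} (ha : a ∈ S) (hb : b ∈ S) {k : ℕ}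
    (hak : f a < k) (hkb : k < f b) : ∃ z ∈ S, f z = k := by
  by_contra! hk
  have hl : IsClosed {z | z ∈ S ∧ f z < k} := isClosed_of_coversRel fun p hp q hq => by
    have hqS := hC.mem_of_specLE hq.1.1 hp.1
    have := hp.2
    have := hk q hqS
    exact ⟨hqS, by have := hf p q hq; omega⟩
  have hr : IsClosed {z | z ∈ S ∧ k < f z} := isClosed_of_coversRel fun p hp q hq => by
    have hqS := hC.mem_of_specLE hq.1.1 hp.1
    have := hp.2
    have := hk q hqS
    exact ⟨hqS, by have := hf p q hq; omega⟩
  obtain ⟨z, -, hz, hz'⟩ := isPreconnected_closed_iff.1 hS _ _ hl hr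
    (fun z hz => (hk z hz).lt_or_gt.imp (fun h => ⟨hz, h⟩) fun h => ⟨hz, h⟩)
    ⟨a, ha, ha, hak⟩ ⟨b, hb, hb, hkb⟩
  exact lt_asymm hz.2 hz'.2

lemma crossing_unique [Finite X] [T0Space X] (hf : AdjacentOnCovers f)
    (hinj : Function.Injective f) {U C : Set X} (hU : IsPreconnected U) (hC : IsPreconnected C)
    (hUo : IsOpen U) (hCc : IsClosed C) (hd : Disjoint U C) {x y x' y' : X}
    (hx : x ∈ U) (hy : y ∈ C) (hx' : x' ∈ U) (hy' : y' ∈ C)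
    (hxy : CoversRel x y) (hxy' : CoversRel x' y') : x = x' ∧ y = y' := by
  have no_U : ∀ a ∈ U, ∀ b ∈ U, ∀ c ∈ C, f a < f c → ¬ f c < f b := by
    intro a ha b hb c hc hac hcb
    obtain ⟨z, hz, hzc⟩ := hf.exists_mem_eq_of_isOpen hU hUo ha hb hac hcb
    exact disjoint_left.1 hd hz (hinj hzc ▸ hc)
  have no_C : ∀ a ∈ C, ∀ b ∈ C, ∀ c ∈ U, f a < f c → ¬ f c < f b := by
    intro a ha b hb c hc hac hcb
    obtain ⟨z, hz, hzc⟩ := hf.exists_mem_eq_of_isClosed hC hCc ha hb hac hcb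
    exact disjoint_left.1 hd hc (hinj hzc ▸ hz)
  have ne : ∀ a ∈ U, ∀ c ∈ C, f a ≠ f c := fun a ha c hc h =>
    disjoint_left.1 hd ha (hinj h ▸ hc)
  have := hf x y hxy
  have := hf x' y' hxy'
  have := ne x hx y' hy'
  have := ne x' hx' y hy
  have := no_U x hx x' hx' y hy
  have := no_U x hx x' hx' y' hy'
  have := no_U x' hx' x hx y hy
  have := no_U x' hx' x hx y' hy'
  have := no_C y hy y' hy' x hx
  have := no_C y hy y' hy' x' hx'
  have := no_C y' hy' y hy x hx
  have := no_C y' hy' y hy x' hx'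
  exact ⟨hinj (by omega), hinj (by omega)⟩

end AdjacentOnCovers

lemma LocClosed.mem_of_specLE {Y : Set X} (hY : LocClosed Y) {a b c : X} (ha : a ∈ Y)
    (hc : c ∈ Y) (hab : SpecLE a b) (hbc : SpecLE b c) : b ∈ Y := by
  obtain ⟨O, V, hO, hV, -, rfl⟩ := hY
  exact ⟨hO.mem_of_specLE hab ha.1, fun hb => hc.2 (hV.mem_of_specLE hbc hb)⟩

lemma exists_crossing [Finite X] [T0Space X] {U C : Set X} (hY : LocClosed (U ∪ C))
    (hd : Disjoint U C) {c u : X} (hc : c ∈ C) (hu : u ∈ U) (h : SpecLE c u) :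
    ∃ x ∈ U, ∃ y ∈ C, CoversRel x y ∧ SpecLE c y ∧ SpecLE x u := by
  revert hc
  refine h.reflTransGen_coversRel.head_induction_on
    (motive := fun c _ => c ∈ C → ∃ x ∈ U, ∃ y ∈ C, CoversRel x y ∧ SpecLE c y ∧ SpecLE x u)
    (fun hc => (disjoint_left.1 hd hu hc).elim) ?_
  intro a b hba hbu ih ha
  have hbu' := specLE_of_reflTransGen hbu
  rcases hY.mem_of_specLE (Or.inr ha) (Or.inl hu) hba.1.1 hbu' with hb | hb
  · exact ⟨b, hb, a, ha, hba, subset_closure rfl, hbu'⟩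
  · obtain ⟨x, hx, y, hy, hxy, hby, hxu⟩ := ih hb
    exact ⟨x, hx, y, hy, hxy, hba.1.1.trans hby, hxu⟩

theorem stmt_7 {X : Type*} [TopologicalSpace X] [Finite X] [T0Space X]
    (h : IsAccordion X) : IsEBP X := by
  obtain ⟨f, hinj, hf⟩ := h.exists_adjacentOnCovers
  refine ⟨hf.uniquePathSpace hinj, ?_⟩
  rintro U C ⟨⟨hY, -, hCU⟩, hU, hC, hUo, hCc, hUC, hcl⟩
  have hd : Disjoint U C := by
    rw [hCU]
    exact disjoint_sdiff_right
  obtain ⟨c₀, hc₀⟩ := hC.nonempty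
  obtain ⟨u₀, hu₀, hcu₀⟩ := exists_specLE_of_mem_closure (hcl hc₀)
  obtain ⟨x, hx, y, hy, hxy, -, -⟩ := exists_crossing hY hd hc₀ hu₀ hcu₀
  have key : ∀ c ∈ C, ∀ u ∈ U, SpecLE c u → SpecLE c y ∧ SpecLE x u := by
    intro c hc u hu hcu
    obtain ⟨x', hx', y', hy', hxy', hcy, hxu⟩ := exists_crossing hY hd hc hu hcu
    obtain ⟨rfl, rfl⟩ := hf.crossing_unique hinj hU.isPreconnected hC.isPreconnected hUo hCc hd
      hx hy hx' hy' hxy hxy'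
    exact ⟨hcy, hxu⟩
  refine ⟨x, y, hxy, Subset.antisymm (fun u hu => ?_) ?_, Subset.antisymm (fun c hc => ?_) ?_⟩
  · obtain ⟨c, hc, hcu⟩ := exists_specLE_of_mem_tildeSet (hUC hu)
    exact fun O hO => hO.1.mem_of_specLE (key c hc u hu hcu).2 (hO.2 rfl)
  · exact sInter_subset_of_mem ⟨hUo, singleton_subset_iff.2 hx⟩
  · obtain ⟨u, hu, hcu⟩ := exists_specLE_of_mem_closure (hcl hc)
    exact (key c hc u hu hcu).1
  · exact closure_minimal (singleton_subset_iff.2 hy) hCc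
end

section
/- Let A be a C*-algebra of real rank zero and let I and J be closed two-sided ideals of A satisfying I + J = A (every element of A is the sum of an element of I and an element of J). Then every projection p in A can be written as p = q + q′ where q is a projection belonging to I and q′ is a projection belonging to J. -/
/-- A (possibly non-unital) C*-algebra `A` has real rank zero if, in the minimal unitization
`Unitization ℂ A`, the invertible self-adjoint elements are dense in the self-adjoint
elements. -/
def RealRankZero (A : Type*) [NonUnitalCStarAlgebra A] : Prop :=
  {x : Unitization ℂ A | IsSelfAdjoint x} ⊆
    closure {x : Unitization ℂ A | IsSelfAdjoint x ∧ IsUnit x}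

section CStarAlgebra

variable {B : Type*} [CStarAlgebra B]

/-- Schur complement argument: if the invertible self-adjoint elements of `B` are dense in the
self-adjoint ones, a self-adjoint `h` with `p * h = h` is such that `h + (1 - p)` can be
approximated by invertible self-adjoint elements commuting with `p`. -/
theorem exists_isUnit_commute_norm_sub_lt
    (hB : {x : B | IsSelfAdjoint x} ⊆ closure {x : B | IsSelfAdjoint x ∧ IsUnit x})
    {p h : B} (hp : IsStarProjection p) (hh : IsSelfAdjoint h) (hph : p * h = h)
    {ε : ℝ} (hε : 0 < ε) :
    ∃ y : B, IsSelfAdjoint y ∧ IsUnit y ∧ Commute p y ∧ ‖y - (h + (1 - p))‖ < ε := by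
  have hpp : p * p = p := hp.isIdempotentElem
  have hps : star p = p := hp.isSelfAdjoint
  obtain ⟨r, hr⟩ : ∃ r, r = 1 - p := ⟨_, rfl⟩
  have hpr : p * r = 0 := by rw [hr, mul_sub, hpp, mul_one, sub_self]
  have hrp : r * p = 0 := by rw [hr, sub_mul, hpp, one_mul, sub_self]
  have hrr : r * r = r := by nth_rw 2 [hr]; rw [mul_sub, hrp, mul_one, sub_zero]
  have hrs : star r = r := by rw [hr, star_sub, star_one, hps]
  have hpr1 : p + r = 1 := by rw [hr]; abel
  have hrh : r * h = 0 := by rw [← hph, ← mul_assoc, hrp, zero_mul]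
  rw [← hr]
  let D : B → B := fun x => p + r * x * r
  let n : B → B := fun x => Ring.inverse (D x) * r * x * p
  let F : B → B := fun x => star (1 - n x) * x * (1 - n x)
  have hDx₀ : D (h + r) = 1 := by
    simp only [D, mul_add, hrh, hrr, zero_add, hpr1]
  have hD : Continuous D := by fun_prop
  have hn₀ : n (h + r) = 0 := by
    simp only [n, hDx₀, Ring.inverse_one, one_mul, mul_add, hrh, hrr, zero_add, hrp]
  have hF₀ : F (h + r) = h + r := by simp [F, hn₀]
  have hinv : ContinuousAt (fun x => Ring.inverse (D x)) (h + r) := by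
    have h1 : ContinuousAt Ring.inverse (D (h + r)) := by
      rw [hDx₀]; exact NormedRing.inverse_continuousAt (1 : Bˣ)
    exact ContinuousAt.comp h1 hD.continuousAt
  have hn : ContinuousAt n (h + r) := by fun_prop
  have hF : ContinuousAt F (h + r) := by fun_prop
  have hev₁ : ∀ᶠ x in nhds (h + r), ‖F x - (h + r)‖ < ε := by
    have := Metric.tendsto_nhds.1 hF ε hε
    simpa only [hF₀, dist_eq_norm] using this
  have hev₂ : ∀ᶠ x in nhds (h + r), IsUnit (D x) := by
    refine hD.continuousAt.eventually_mem (Units.isOpen.mem_nhds ?_)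
    simp [hDx₀]
  have hx₀ : h + r ∈ closure {x : B | IsSelfAdjoint x ∧ IsUnit x} :=
    hB (hh.add hrs)
  obtain ⟨x, ⟨hxs, hxu⟩, hx₁, hx₂⟩ :=
    ((mem_closure_iff_frequently.1 hx₀).and_eventually (hev₁.and hev₂)).exists
  have hxs' : star x = x := hxs
  have hDs : star (D x) = D x := by
    simp only [D, star_add, star_mul, hps, hrs, hxs', mul_assoc]
  have hrD : r * D x = r * x * r := by
    simp only [D, mul_add, hrp, zero_add, ← mul_assoc, hrr]
  have hDr : D x * r = r * x * r := by
    simp only [D, add_mul, hpr, zero_add, mul_assoc, hrr]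
  obtain ⟨d, hd⟩ : ∃ d, d = Ring.inverse (D x) := ⟨_, rfl⟩
  have hDd : D x * d = 1 := by rw [hd]; exact Ring.mul_inverse_cancel _ hx₂
  have hdD : d * D x = 1 := by rw [hd]; exact Ring.inverse_mul_cancel _ hx₂
  have hrd : r * d = d * r := by
    calc r * d = d * D x * r * d := by rw [hdD, one_mul]
      _ = d * (D x * r) * d := by noncomm_ring
      _ = d * (r * D x) * d := by rw [hDr, hrD]
      _ = d * r * (D x * d) := by noncomm_ring
      _ = d * r := by rw [hDd, mul_one]
  obtain ⟨m, hm⟩ : ∃ m, m = n x := ⟨_, rfl⟩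
  have hm' : m = d * r * x * p := by rw [hm, hd]
  have hmp : m * p = m := by rw [hm', mul_assoc, hpp]
  have hrm : r * m = m := by
    rw [hm', ← mul_assoc, ← mul_assoc, ← mul_assoc, hrd, mul_assoc d, hrr]
  have hmm : m * m = 0 := by
    calc m * m = (m * p) * (r * m) := by rw [hmp, hrm]
      _ = m * (p * r) * m := by noncomm_ring
      _ = 0 := by rw [hpr, mul_zero, zero_mul]
  have hrsm : r * star m = 0 := by
    have h1 : star (m * r) = 0 := by rw [← hmp, mul_assoc, hpr, mul_zero, star_zero]
    rwa [star_mul, hrs] at h1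
  have hrxm : r * x * m = r * x * p := by
    calc r * x * m = r * x * (r * m) := by rw [hrm]
      _ = (r * x * r) * m := by noncomm_ring
      _ = r * D x * (d * r * x * p) := by rw [hrD, ← hm']
      _ = r * (D x * d) * r * x * p := by noncomm_ring
      _ = r * x * p := by rw [hDd, mul_one, hrr]
  have hu : IsUnit (1 - m) := by
    refine ⟨⟨1 - m, 1 + m, ?_, ?_⟩, rfl⟩
    · calc (1 - m) * (1 + m) = 1 - m * m := by noncomm_ring
        _ = 1 := by rw [hmm, sub_zero]
    · calc (1 + m) * (1 - m) = 1 - m * m := by noncomm_ring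
        _ = 1 := by rw [hmm, sub_zero]
  have hFx : F x = star (1 - m) * x * (1 - m) := by rw [hm]
  have hFs : star (F x) = F x := by
    rw [hFx]; simp only [star_mul, star_star, hxs', mul_assoc]
  have hrFp : r * F x * p = 0 := by
    calc r * F x * p = (r - r * star m) * x * (p - m * p) := by
          rw [hFx, star_sub, star_one]; noncomm_ring
      _ = r * x * p - r * x * m := by rw [hrsm, hmp]; noncomm_ring
      _ = 0 := by rw [hrxm, sub_self]
  have hFp : F x * p = p * F x * p := by
    calc F x * p = (p + r) * F x * p := by rw [hpr1, one_mul]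
      _ = p * F x * p + r * F x * p := by noncomm_ring
      _ = p * F x * p := by rw [hrFp, add_zero]
  have hpF : p * F x = p * F x * p := by
    have := congrArg star hFp
    simpa only [star_mul, hFs, hps, mul_assoc] using this
  refine ⟨F x, hFs, ?_, hpF.trans hFp.symm, hx₁⟩
  rw [hFx]
  exact (hu.star.mul hxu).mul hu

variable [PartialOrder B] [StarOrderedRing B]

/-- An element of a corner whose real part is bounded below is left invertible in the corner. -/
theorem exists_mul_eq_of_smul_le {q k : B} (hq : IsStarProjection q)
    (hk : (1 / 2 : ℝ) • q ≤ q * (k + star k) * q) : ∃ w : B, w * (q * k * q) = q := by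
  have hqq : q * q = q := hq.isIdempotentElem
  have hqs : star q = q := hq.isSelfAdjoint
  obtain ⟨z, hz⟩ : ∃ z, z = q * k * q + (1 - q) := ⟨_, rfl⟩
  have hzq : z * q = q * k * q := by
    rw [hz, add_mul, sub_mul, mul_assoc, hqq, one_mul, sub_self, add_zero]
  have hzz : (1 / 2 : ℝ) • (1 : B) ≤ z + star z := by
    have h1 : (0 : B) ≤ (3 / 2 : ℝ) • (1 - q) := smul_nonneg (by norm_num) hq.one_sub.nonneg
    have h2 : z + star z = q * (k + star k) * q + (2 : ℝ) • (1 - q) := by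
      rw [hz, two_smul]
      simp only [star_add, star_mul, star_sub, star_one, hqs]
      noncomm_ring
    have h3 : (1 / 2 : ℝ) • (1 : B) =
        (1 / 2 : ℝ) • q + ((2 : ℝ) • (1 - q) - (3 / 2 : ℝ) • (1 - q)) := by module
    rw [h2, h3]
    exact add_le_add hk (sub_le_self _ h1)
  have hsq : (1 / 16 : ℝ) • (1 : B) ≤ star z * z := by
    have h1 : 0 ≤ star (z - (1 / 4 : ℝ) • (1 : B)) * (z - (1 / 4 : ℝ) • (1 : B)) :=
      star_mul_self_nonneg _
    have h2 : star (z - (1 / 4 : ℝ) • (1 : B)) * (z - (1 / 4 : ℝ) • (1 : B)) =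
        star z * z - (1 / 4 : ℝ) • (z + star z) + (1 / 16 : ℝ) • (1 : B) := by
      simp only [star_sub, star_smul, star_one, star_trivial, sub_mul, mul_sub, smul_mul_assoc,
        mul_smul_comm, one_mul, mul_one]
      module
    have h3 := smul_le_smul_of_nonneg_left hzz (show (0 : ℝ) ≤ 1 / 4 by norm_num)
    rw [h2] at h1
    have h4 : star z * z - (1 / 16 : ℝ) • (1 : B) =
        (star z * z - (1 / 4 : ℝ) • (z + star z) + (1 / 16 : ℝ) • (1 : B)) +
        ((1 / 4 : ℝ) • (z + star z) - (1 / 4 : ℝ) • (1 / 2 : ℝ) • (1 : B)) := by module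
    rw [← sub_nonneg, h4]
    exact add_nonneg h1 (sub_nonneg.2 h3)
  have hu : IsUnit (star z * z) :=
    CStarAlgebra.isUnit_of_le _ hsq (isStrictlyPositive_one.smul (by norm_num))
  obtain ⟨u, hu⟩ := hu
  refine ⟨↑u⁻¹ * star z, ?_⟩
  rw [← hzq, ← mul_assoc, mul_assoc _ (star z) z, ← hu, Units.inv_mul, one_mul]

/-- A self-adjoint invertible element has a positive spectral projection. -/
theorem exists_isStarProjection_mul_nonneg {y : B} (hy : IsSelfAdjoint y) (hu : IsUnit y) :
    ∃ Q : B, IsStarProjection Q ∧ (∀ p, Commute p y → Commute p Q) ∧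
      0 ≤ Q * y * Q ∧ (1 - Q) * y * (1 - Q) ≤ 0 := by
  have h0 : ∀ t ∈ spectrum ℝ y, t ≠ 0 := fun t ht h => spectrum.zero_notMem ℝ hu (h ▸ ht)
  let f : ℝ → ℝ := fun t => if 0 < t then 1 else 0
  have hf : ContinuousOn f (spectrum ℝ y) := by
    intro t ht
    apply ContinuousAt.continuousWithinAt
    rcases lt_or_gt_of_ne (h0 t ht) with h | h
    · refine (continuousAt_const (y := (0 : ℝ))).congr ?_
      filter_upwards [Iio_mem_nhds h] with s hs
      simp [f, not_lt.2 (le_of_lt (Set.mem_Iio.1 hs))]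
    · refine (continuousAt_const (y := (1 : ℝ))).congr ?_
      filter_upwards [Ioi_mem_nhds h] with s hs
      simp [f, Set.mem_Ioi.1 hs]
  have hid : cfc (fun t : ℝ => t) y = y := cfc_id' ℝ y
  refine ⟨cfc f y, ⟨?_, cfc_predicate f y⟩, fun p hp => ?_, ?_, ?_⟩
  · show cfc f y * cfc f y = cfc f y
    rw [← cfc_mul f f y]
    refine cfc_congr fun t _ => ?_
    simp only [f]; split_ifs <;> simp
  · exact ((hp.symm).cfc_real f).symm
  · nth_rw 2 [← hid]
    rw [← cfc_mul f _ y, ← cfc_mul _ f y]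
    refine cfc_nonneg fun t _ => ?_
    simp only [f]; split_ifs with h
    · simpa using h.le
    · simp
  · have h1 : 1 - cfc f y = cfc (fun t => 1 - f t) y := by
      rw [cfc_sub (fun _ => 1) f y, cfc_const_one ℝ y]
    rw [h1]
    nth_rw 2 [← hid]
    rw [← cfc_mul _ _ y, ← cfc_mul _ _ y]
    refine cfc_nonpos _ _ fun t _ => ?_
    simp only [f]; split_ifs with h <;> simp [not_lt.1, *]

/-- In a unital C⋆-algebra of real rank zero, every `a` in a corner `p B p` admits a projection
`q ≤ p` such that the real parts of `a` and of `p - a` are bounded below by `1 / 4` in the corners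
of `q` and of `p - q` respectively. -/
theorem exists_isStarProjection_smul_le
    (hB : {x : B | IsSelfAdjoint x} ⊆ closure {x : B | IsSelfAdjoint x ∧ IsUnit x})
    {p a : B} (hp : IsStarProjection p) (hpa : p * a = a) (hap : a * p = a) :
    ∃ q : B, IsStarProjection q ∧ IsStarProjection (p - q) ∧ p * q = q ∧
      (1 / 2 : ℝ) • q ≤ q * (a + star a) * q ∧
      (1 / 2 : ℝ) • (p - q) ≤ (p - q) * ((p - a) + star (p - a)) * (p - q) := by
  have hpp : p * p = p := hp.isIdempotentElem
  have hps : star p = p := hp.isSelfAdjoint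
  have hpa' : p * star a = star a := by simpa [hps] using congrArg star hap
  obtain ⟨y, hys, hyu, hpy, hy⟩ := exists_isUnit_commute_norm_sub_lt hB hp
    (h := (a + star a) - p) ((IsSelfAdjoint.add_star_self a).sub hp.isSelfAdjoint)
    (by rw [mul_sub, mul_add, hpa, hpa', hpp])
    (show (0 : ℝ) < 1 / 2 by norm_num)
  obtain ⟨Q, hQ, hcomm, hQ₁, hQ₂⟩ := exists_isStarProjection_mul_nonneg hys hyu
  have hpQ := hcomm p hpy
  obtain ⟨e, he⟩ : ∃ e, e = y - (a + star a - p + (1 - p)) := ⟨_, rfl⟩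
  rw [← he] at hy
  have hes : IsSelfAdjoint e := by
    rw [he]
    exact hys.sub (((IsSelfAdjoint.add_star_self a).sub hp.isSelfAdjoint).add
      hp.one_sub.isSelfAdjoint)
  have he₁ : e ≤ (1 / 2 : ℝ) • (1 : B) := by
    have h1 := hes.le_algebraMap_norm_self
    rw [Algebra.algebraMap_eq_smul_one] at h1
    exact h1.trans (smul_le_smul_of_nonneg_right hy.le zero_le_one)
  have he₂ : -((1 / 2 : ℝ) • (1 : B)) ≤ e := by
    have h1 := hes.neg_algebraMap_norm_le_self
    rw [Algebra.algebraMap_eq_smul_one] at h1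
    exact (neg_le_neg (smul_le_smul_of_nonneg_right hy.le zero_le_one)).trans h1
  have hq : IsStarProjection (p * Q) := hp.mul hQ hpQ
  have hs : p - p * Q = p * (1 - Q) := by rw [mul_sub, mul_one]
  have hs' : IsStarProjection (p - p * Q) := by
    rw [hs]; exact hp.mul hQ.one_sub ((Commute.one_right p).sub_right hpQ)
  have key : ∀ t : B, IsStarProjection t → p * t = t → t * p = t →
      t * (a + star a) * t = t * y * t + t - t * e * t := by
    intro t ht h1 h2
    have htt : t * t = t := ht.isIdempotentElem
    have h3 : a + star a = y - e - 1 + p + p := by rw [he]; abel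
    rw [h3]
    simp only [mul_add, mul_sub, add_mul, sub_mul, h2, mul_one, htt]
    abel
  have conj : ∀ t : B, IsStarProjection t → ∀ u v : B, u ≤ v → t * u * t ≤ t * v * t := by
    intro t ht u v huv
    have := star_left_conjugate_le_conjugate huv t
    rwa [ht.isSelfAdjoint.star_eq] at this
  refine ⟨p * Q, hq, hs', by rw [← mul_assoc, hpp], ?_, ?_⟩
  · rw [key _ hq (by rw [← mul_assoc, hpp]) (by rw [mul_assoc, ← hpQ.eq, ← mul_assoc, hpp])]
    have h1 := conj _ hq _ _ he₁
    have h2 : 0 ≤ (p * Q) * y * (p * Q) := by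
      have h3 := conj _ hp _ _ hQ₁
      have h4 : p * Q * y * (p * Q) = p * (Q * y * Q) * p := by
        nth_rw 2 [hpQ.eq]; noncomm_ring
      rw [h4]; simpa using h3
    rw [mul_smul_comm, mul_one, smul_mul_assoc, hq.isIdempotentElem.eq] at h1
    calc (1 / 2 : ℝ) • (p * Q) = 0 + p * Q - (1 / 2 : ℝ) • (p * Q) := by module
      _ ≤ _ := sub_le_sub (add_le_add_left h2 _) h1
  · have hps₁ : p * (p - p * Q) = p - p * Q := by rw [mul_sub, ← mul_assoc, hpp]
    have hps₂ : (p - p * Q) * p = p - p * Q := by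
      rw [sub_mul, hpp, mul_assoc, ← hpQ.eq, ← mul_assoc, hpp]
    have h1 := conj _ hs' _ _ he₂
    have h2 : (p - p * Q) * y * (p - p * Q) ≤ 0 := by
      have h3 := conj _ hp _ _ hQ₂
      have h4 : (p - p * Q) * y * (p - p * Q) = p * ((1 - Q) * y * (1 - Q)) * p := by
        nth_rw 2 [hpQ.eq]; nth_rw 1 [hs]; noncomm_ring
      rw [h4]; simpa using h3
    have h3 := key _ hs' hps₁ hps₂
    generalize p - p * Q = s at *
    have hss : s * s = s := hs'.isIdempotentElem
    rw [mul_neg, neg_mul, mul_smul_comm, mul_one, smul_mul_assoc, hss] at h1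
    have h4 : s * (p - a + star (p - a)) * s = s + s - s * (a + star a) * s := by
      rw [star_sub, hps]
      simp only [mul_add, mul_sub, add_mul, sub_mul, hps₂, hss]
      abel
    rw [h4, h3]
    calc (1 / 2 : ℝ) • s = s - 0 + -((1 / 2 : ℝ) • s) := by module
      _ ≤ s - s * y * s + s * e * s := add_le_add (sub_le_sub_left h2 _) h1
      _ = _ := by abel

end CStarAlgebra

/-- A projection `q` in a C⋆-algebra lies in a two-sided ideal as soon as some compression `q k q`
of an element of the ideal has real part bounded below in the corner of `q`. -/
theorem TwoSidedIdeal.mem_of_unitization_mul_eq {A : Type*} [NonUnitalCStarAlgebra A]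
    (K : TwoSidedIdeal A) {q k : A} (hk : k ∈ K) {w : Unitization ℂ A}
    (hw : w * ((q : Unitization ℂ A) * k * q) = q) : q ∈ K := by
  have h : q = (w.fst • q) * k * q + w.snd * (q * k * q) := by
    apply Unitization.inr_injective (R := ℂ)
    conv_lhs => rw [← hw, ← Unitization.inl_fst_add_inr_snd_eq w]
    rw [add_mul]
    simp only [← Unitization.inr_mul, Unitization.inl_mul_inr, ← Unitization.inr_add,
      smul_mul_assoc]
  rw [h]
  exact K.add_mem (K.mul_mem_right _ _ (K.mul_mem_left _ _ hk))
    (K.mul_mem_left _ _ (K.mul_mem_right _ _ (K.mul_mem_left _ _ hk)))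

theorem stmt_9 {A : Type*} [NonUnitalCStarAlgebra A] (hA : RealRankZero A)
    (I J : TwoSidedIdeal A) (hI : IsClosed (I : Set A)) (hJ : IsClosed (J : Set A))
    (hIJ : ∀ a : A, ∃ i ∈ I, ∃ j ∈ J, a = i + j)
    (p : A) (hp₁ : star p = p) (hp₂ : p * p = p) :
    ∃ q q' : A, q ∈ I ∧ q' ∈ J ∧ star q = q ∧ q * q = q ∧
      star q' = q' ∧ q' * q' = q' ∧ p = q + q' := by
  let _ : PartialOrder (Unitization ℂ A) := CStarAlgebra.spectralOrder _
  have _ : StarOrderedRing (Unitization ℂ A) := CStarAlgebra.spectralOrderedRing _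
  obtain ⟨i, hi, j, hj, hij⟩ := hIJ p
  have hpI : p * i * p ∈ I := I.mul_mem_right _ _ (I.mul_mem_left _ _ hi)
  have hpJ : p - p * i * p ∈ J := by
    have h : p - p * i * p = p * j * p := by
      have h1 : p * (i + j) * p = p := by rw [← hij, hp₂, hp₂]
      nth_rw 1 [← h1]
      noncomm_ring
    rw [h]
    exact J.mul_mem_right _ _ (J.mul_mem_left _ _ hj)
  have hp : IsStarProjection (p : Unitization ℂ A) :=
    ⟨by rw [IsIdempotentElem, ← Unitization.inr_mul, hp₂],
      by rw [IsSelfAdjoint, ← Unitization.inr_star, hp₁]⟩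
  obtain ⟨Q, hQ, hQ', hpQ, h₁, h₂⟩ := exists_isStarProjection_smul_le hA hp
    (a := ((p * i * p : A) : Unitization ℂ A))
    (by rw [← Unitization.inr_mul, ← mul_assoc, ← mul_assoc, hp₂])
    (by rw [← Unitization.inr_mul, mul_assoc, hp₂])
  obtain ⟨q, rfl⟩ : ∃ q : A, (q : Unitization ℂ A) = Q := by
    refine ⟨Q.snd, Unitization.ext ?_ (by simp)⟩
    rw [← hpQ]
    simp
  obtain ⟨w₁, hw₁⟩ := exists_mul_eq_of_smul_le hQ h₁
  obtain ⟨w₂, hw₂⟩ := exists_mul_eq_of_smul_le hQ' h₂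
  simp only [← Unitization.inr_sub] at hw₂ hQ'
  have inj := Unitization.inr_injective (R := ℂ) (A := A)
  refine ⟨q, p - q, I.mem_of_unitization_mul_eq hpI hw₁, J.mem_of_unitization_mul_eq hpJ hw₂,
    inj ?_, inj ?_, inj ?_, inj ?_, by abel⟩
  · rw [Unitization.inr_star]; exact hQ.isSelfAdjoint
  · rw [Unitization.inr_mul]; exact hQ.isIdempotentElem
  · rw [Unitization.inr_star]; exact hQ'.isSelfAdjoint
  · rw [Unitization.inr_mul]; exact hQ'.isIdempotentElem
end

section
/- Let X be a finite T₀ topological space and let Y, Z, W be locally closed subsets of X such that Y ∪ W is locally closed and contains both Y and W as relatively closed subsets, Z ∪ W is locally closed and contains both Z and W as relatively open subsets, and W ⊆ Y ∪ Z. Then W \ Y is contained in Z ∩ W and is relatively open in Z ∩ W, and W \ Z is contained in Y ∩ W and is relatively closed in Y ∩ W. -/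
open Set Topology

variable {X : Type*} [TopologicalSpace X]

theorem stmt_12 {X : Type*} [TopologicalSpace X] [Finite X] [T0Space X]
    {Y Z W : Set X} (hY : LocClosed Y) (hZ : LocClosed Z) (hW : LocClosed W)
    (hYW : LocClosed (Y ∪ W)) (hYc : RelClosed Y (Y ∪ W)) (hWc : RelClosed W (Y ∪ W))
    (hZW : LocClosed (Z ∪ W)) (hZo : RelOpen Z (Z ∪ W)) (hWo : RelOpen W (Z ∪ W))
    (hWYZ : W ⊆ Y ∪ Z) :
    (W \ Y ⊆ Z ∩ W ∧ RelOpen (W \ Y) (Z ∩ W)) ∧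
    (W \ Z ⊆ Y ∩ W ∧ RelClosed (W \ Z) (Y ∩ W)) := by
  obtain ⟨C, hC, hYC⟩ := hYc
  obtain ⟨O, hO, hZO⟩ := hZo
  have memY : ∀ x ∈ W, (x ∈ Y ↔ x ∈ C) := fun x hx => by
    conv_lhs => rw [hYC]
    exact and_iff_left (Or.inr hx)
  have memZ : ∀ x ∈ W, (x ∈ Z ↔ x ∈ O) := fun x hx => by
    conv_lhs => rw [hZO]
    exact and_iff_left (Or.inr hx)
  have hWY : W \ Y ⊆ Z ∩ W := fun x hx => ⟨(hWYZ hx.1).resolve_left hx.2, hx.1⟩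
  have hWZ : W \ Z ⊆ Y ∩ W := fun x hx => ⟨(hWYZ hx.1).resolve_right hx.2, hx.1⟩
  refine ⟨⟨hWY, Cᶜ, hC.isOpen_compl, ?_⟩, hWZ, Oᶜ, hO.isClosed_compl, ?_⟩
  · ext x
    exact ⟨fun hx => ⟨fun h => hx.2 ((memY x hx.1).2 h), hWY hx⟩,
      fun hx => ⟨hx.2.2, fun h => hx.1 ((memY x hx.2.2).1 h)⟩⟩
  · ext x
    exact ⟨fun hx => ⟨fun h => hx.2 ((memZ x hx.1).2 h), hWZ hx⟩,
      fun hx => ⟨hx.2.2, fun h => hx.1 ((memZ x hx.2.2).1 h)⟩⟩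
end

section
/- Let X be a finite T₀ topological space that is a unique path space, and let (U, C) be a boundary pair in X such that the smallest open set containing U equals õ{x} and the closure of C equals closure {y}, for points x, y ∈ X with x covering y in the specialization order. Then x ∈ U, y ∈ C, and (x, y) is the only pair (u, c) with u ∈ U, c ∈ C, and u covering c. -/
open Set Topology

variable {X : Type*} [TopologicalSpace X]

theorem specLE_iff_specializes_s15 {X : Type*} [TopologicalSpace X] {a b : X} :
    SpecLE a b ↔ b ⤳ a :=
  specializes_iff_mem_closure.symm

theorem mem_tildeSet_iff {X : Type*} [TopologicalSpace X] {S : Set X} {a : X} :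
    a ∈ tildeSet S ↔ ∃ s ∈ S, a ⤳ s := by
  rw [tildeSet, ← nhdsKer_def, mem_nhdsKer_iff_specializes]

theorem mem_osi_iff {X : Type*} [TopologicalSpace X] {a x : X} : a ∈ osi x ↔ a ⤳ x := by
  simp [osi, mem_tildeSet_iff]

theorem mem_closure_iff_exists_specializes {X : Type*} [TopologicalSpace X] [Finite X]
    {S : Set X} {a : X} : a ∈ closure S ↔ ∃ s ∈ S, s ⤳ a := by
  conv_lhs => rw [← biUnion_of_singleton S, S.toFinite.closure_biUnion]
  simp [specializes_iff_mem_closure]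

theorem mem_of_tildeSet_eq_osi {X : Type*} [TopologicalSpace X] [T0Space X] {U : Set X} {x : X}
    (hU : tildeSet U = osi x) : x ∈ U := by
  obtain ⟨u, hu, hxu⟩ := mem_tildeSet_iff.1 (hU ▸ mem_osi_iff.2 specializes_rfl : x ∈ tildeSet U)
  have hux : u ⤳ x := mem_osi_iff.1 (hU ▸ mem_tildeSet_iff.2 ⟨u, hu, specializes_rfl⟩)
  exact (hxu.antisymm hux).eq ▸ hu

theorem mem_of_closure_eq_closure_singleton {X : Type*} [TopologicalSpace X] [Finite X]
    [T0Space X] {C : Set X} {y : X} (hC : closure C = closure ({y} : Set X)) : y ∈ C := by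
  obtain ⟨c, hc, hcy⟩ := mem_closure_iff_exists_specializes.1
    (hC ▸ subset_closure rfl : y ∈ closure C)
  have hyc : y ⤳ c := specializes_iff_mem_closure.2 (hC ▸ subset_closure hc)
  exact (hyc.antisymm hcy).eq ▸ hc

/-- A covering pair has no proper covering pair inside its interval. -/
theorem CoversRel.eq_and_eq_of_le {X : Type*} [TopologicalSpace X] [T0Space X] {u c x y : X}
    (huc : CoversRel u c) (hxy : SpecLT y x) (hu : SpecLE x u) (hc : SpecLE c y) :
    u = x ∧ c = y := by
  obtain ⟨-, hbetween⟩ := huc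
  simp only [SpecLT, specLE_iff_specializes_s15] at *
  constructor
  · by_contra hne
    exact hbetween x ⟨⟨hxy.1.trans hc, fun h => hxy.2 (hc.trans h)⟩,
      hu, fun h => hne (hu.antisymm h).eq⟩
  · by_contra hne
    exact hbetween y ⟨⟨hc, fun h => hne (h.antisymm hc).eq⟩,
      hu.trans hxy.1, fun h => hxy.2 (h.trans hu)⟩

theorem stmt_15 {X : Type*} [TopologicalSpace X] [Finite X] [T0Space X]
    (hX : UniquePathSpace X) {U C : Set X} (h : BoundaryPair U C)
    {x y : X} (hxy : CoversRel x y)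
    (hU : tildeSet U = osi x) (hC : closure C = closure ({y} : Set X)) :
    x ∈ U ∧ y ∈ C ∧ ∀ u c : X, u ∈ U → c ∈ C → CoversRel u c → u = x ∧ c = y := by
  refine ⟨mem_of_tildeSet_eq_osi hU, mem_of_closure_eq_closure_singleton hC,
    fun u c hu hc huc => huc.eq_and_eq_of_le hxy.1 ?_ ?_⟩
  · exact specLE_iff_specializes_s15.2
      (mem_osi_iff.1 (hU ▸ mem_tildeSet_iff.2 ⟨u, hu, specializes_rfl⟩))
  · exact (hC ▸ subset_closure hc : c ∈ closure ({y} : Set X))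
end

section
/- Let X be a finite T₀ topological space and let (U, C) be an elementary boundary pair in X. Then there exist a minimal element x of U and an element y ∈ C such that x covers y in the specialization order. -/
open Set Topology

variable {X : Type*} [TopologicalSpace X]

theorem SpecLE.mem_of_isOpen {x y : X} (hxy : SpecLE x y) {S : Set X} (hS : IsOpen S)
    (hx : x ∈ S) : y ∈ S :=
  (specializes_iff_mem_closure.2 hxy).mem_open hS hx

theorem SpecLE.mem_of_isClosed {x y : X} (hxy : SpecLE x y) {S : Set X} (hS : IsClosed S)
    (hy : y ∈ S) : x ∈ S :=
  (specializes_iff_mem_closure.2 hxy).mem_closed hS hy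

theorem exists_specLE_minimal [Finite X] [T0Space X] {S : Set X} (hS : S.Nonempty) :
    ∃ x ∈ S, ∀ u ∈ S, SpecLE u x → u = x := by
  let := specializationOrder X
  obtain ⟨x, hx⟩ := S.toFinite.exists_minimal hS
  refine ⟨x, hx.prop, fun u hu hux => ?_⟩
  have hle : u ≤ x := specializes_iff_mem_closure.2 hux
  exact le_antisymm hle (hx.le_of_le hu hle)

theorem exists_specLE_maximal [Finite X] [T0Space X] {S : Set X} (hS : S.Nonempty) :
    ∃ x ∈ S, ∀ u ∈ S, SpecLE x u → u = x := by
  let := specializationOrder X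
  obtain ⟨x, hx⟩ := S.toFinite.exists_maximal hS
  refine ⟨x, hx.prop, fun u hu hxu => ?_⟩
  have hle : x ≤ u := specializes_iff_mem_closure.2 hxu
  exact le_antisymm (hx.le_of_ge hu hle) hle

/-- Every point of the smallest open set containing `S` lies above a point of `S`. -/
theorem exists_specLE_of_mem_tildeSet_s16 {S : Set X} {x : X} (hx : x ∈ tildeSet S) :
    ∃ y ∈ S, SpecLE y x := by
  by_contra! hne
  exact hx (closure {x})ᶜ ⟨isClosed_closure.isOpen_compl, hne⟩ (subset_closure rfl)

/-- Locally closed sets are convex in the specialization order. -/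
theorem LocClosed.mem_of_specLE_of_specLE {S : Set X} (hS : LocClosed S) {x y z : X}
    (hx : x ∈ S) (hy : y ∈ S) (hxz : SpecLE x z) (hzy : SpecLE z y) : z ∈ S := by
  obtain ⟨A, B, hA, hB, -, rfl⟩ := hS
  exact ⟨hxz.mem_of_isOpen hA hx.1, fun hz => hy.2 (hzy.mem_of_isOpen hB hz)⟩

theorem stmt_16 {X : Type*} [TopologicalSpace X] [Finite X] [T0Space X]
    {U C : Set X} (h : ElementaryBP U C) :
    ∃ x ∈ U, (∀ u ∈ U, SpecLE u x → u = x) ∧ ∃ y ∈ C, CoversRel x y := by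
  obtain ⟨⟨hloc, -, hdiff⟩, hU, -, -, hC, hUC, -⟩ := h
  obtain ⟨x, hxU, hmin⟩ := exists_specLE_minimal hU.nonempty
  have hxC : x ∉ C := fun hx => (hdiff ▸ hx : x ∈ (U ∪ C) \ U).2 hxU
  obtain ⟨c, hc, hcx⟩ := exists_specLE_of_mem_tildeSet_s16 (hUC hxU)
  obtain ⟨y, ⟨hyC, hyx⟩, hmax⟩ :=
    exists_specLE_maximal (S := {y | y ∈ C ∧ SpecLE y x}) ⟨c, hc, hcx⟩
  refine ⟨x, hxU, hmin, y, hyC, ⟨hyx, fun hxy => hxC (hxy.mem_of_isClosed hC hyC)⟩, ?_⟩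
  rintro z ⟨⟨hyz, hzy⟩, hzx, hxz⟩
  rcases hloc.mem_of_specLE_of_specLE (Or.inr hyC) (Or.inl hxU) hyz hzx with hzU | hzC
  · obtain rfl := hmin z hzU hzx
    exact hxz hzx
  · obtain rfl := hmax z ⟨hzC, hzx⟩ hyz
    exact hzy hyz
end
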